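/- arXiv:1307.0669 — 6 statements merged into one kernel-verified Lean document; each statement's English description precedes it below -/
import Mathlib

section
/- Let p be an odd prime, let n ≥ 2 be an integer, and let m₁, …, mₙ be integers with 1 ≤ mᵢ ≤ p−1 for all i. Let Φ be the polynomial (∏_{i=1}^{n}(sᵢ+1)^{mᵢ} − 1)^p in ℤ[s₁, …, sₙ], and for integers 1 ≤ j₁, …, jₙ ≤ p−1 let C_{j₁⋯jₙ} denote the coefficient of the monomial s₁^{j₁}⋯sₙ^{jₙ} in Φ. Then p² divides the alternating sum ∑_{j₁=1}^{p−1}⋯∑_{jₙ=1}^{p−1} (−1)^{j₁+⋯+jₙ} C_{j₁⋯jₙ}. -/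
open MvPolynomial

theorem coeff_prod_X_add_one_pow {R σ : Type*} [CommSemiring R] [Fintype σ]
    (a : σ → ℕ) (j : σ →₀ ℕ) :
    coeff j (∏ i, (X i + 1 : MvPolynomial σ R) ^ a i) = ∏ i, ((a i).choose (j i) : R) := by
  classical
  have hprod : (∏ i, (X i + 1 : MvPolynomial σ R) ^ a i) =
      ∑ t ∈ Fintype.piFinset (fun i => Finset.range (a i + 1)),
        monomial (Finsupp.equivFunOnFinite.symm t) (∏ i, ((a i).choose (t i) : R)) := by
    simp_rw [add_pow, one_pow, mul_one]
    rw [Finset.prod_univ_sum]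
    refine Finset.sum_congr rfl fun t _ => ?_
    rw [Finset.prod_mul_distrib, monomial_eq, Finsupp.prod_fintype _ _ (by simp), mul_comm]
    simp
  rw [hprod, coeff_sum]
  simp_rw [coeff_monomial, Equiv.symm_apply_eq]
  rw [Finset.sum_ite_eq']
  split_ifs with h
  · rfl
  · obtain ⟨i, hi⟩ : ∃ i, a i < j i := by simpa using h
    rw [Finset.prod_eq_zero (Finset.mem_univ i)]
    rw [Nat.choose_eq_zero_of_lt hi, Nat.cast_zero]

/-- The sum `∑_{0 < j < p} (-1) ^ j * M.choose j`. -/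
def truncatedAlternatingSum (p M : ℕ) : ℤ :=
  ∑ j ∈ Finset.Icc 1 (p - 1), (-1) ^ j * (M.choose j : ℤ)

theorem dvd_truncatedAlternatingSum {p M : ℕ} (hp : p.Prime) (h : p ∣ M) :
    (p : ℤ) ∣ truncatedAlternatingSum p M := by
  refine Finset.dvd_sum fun j hj => Dvd.dvd.mul_left ?_ _
  rw [Finset.mem_Icc] at hj
  obtain ⟨j, rfl⟩ : ∃ i, j = i + 1 := ⟨j - 1, by omega⟩
  rw [Int.natCast_dvd_natCast]
  rcases M with _ | M
  · simp
  have hmul := Nat.add_one_mul_choose_eq M j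
  have hdvd : p ∣ (M + 1).choose (j + 1) * (j + 1) := hmul ▸ h.mul_right _
  exact (hp.dvd_mul.1 hdvd).resolve_right (Nat.not_dvd_of_pos_of_lt j.succ_pos (by omega))

theorem dvd_truncatedAlternatingSum_add_one {p M : ℕ} (hp : p.Prime) (h : ¬ p ∣ M) :
    (p : ℤ) ∣ truncatedAlternatingSum p M + 1 := by
  obtain ⟨q, rfl⟩ : ∃ q, p = q + 1 := ⟨p - 1, by have := hp.pos; omega⟩
  obtain ⟨N, rfl⟩ : ∃ N, M = N + 1 := ⟨M - 1, by rcases M with _ | M <;> simp_all⟩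
  have hsum : truncatedAlternatingSum (q + 1) (N + 1) + 1 = (-1) ^ q * (N.choose q : ℤ) := by
    rw [← Int.alternating_sum_range_choose_eq_choose, Finset.sum_range_succ',
      truncatedAlternatingSum, Finset.range_eq_Ico, Finset.sum_Ico_add'
        (fun i => (-1 : ℤ) ^ i * ((N + 1).choose i : ℤ)) 0 q 1]
    simp [← Finset.Ico_add_one_right_eq_Icc]
  rw [hsum]
  refine Dvd.dvd.mul_left (Int.natCast_dvd_natCast.2 ?_) _
  have hmul := Nat.add_one_mul_choose_eq N q
  exact (hp.dvd_mul.1 (hmul ▸ dvd_mul_left _ _)).resolve_left h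

theorem sum_coeff_prod_pow_sub_one_pow (p n : ℕ) (m : Fin n → ℕ) :
    ∑ j ∈ Fintype.piFinset (fun _ : Fin n => Finset.Icc 1 (p - 1)),
        (-1 : ℤ) ^ (∑ i, j i) *
          MvPolynomial.coeff (Finsupp.equivFunOnFinite.symm j)
            (((∏ i, (X i + 1) ^ m i) - 1) ^ p : MvPolynomial (Fin n) ℤ) =
      ∑ k ∈ Finset.range (p + 1),
        (-1) ^ (p - k) * (p.choose k : ℤ) * ∏ i, truncatedAlternatingSum p (m i * k) := by
  have hcoeff (j : Fin n →₀ ℕ) :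
      coeff j (((∏ i, (X i + 1) ^ m i) - 1) ^ p : MvPolynomial (Fin n) ℤ) =
        ∑ k ∈ Finset.range (p + 1),
          (-1) ^ (p - k) * (p.choose k : ℤ) * ∏ i, ((m i * k).choose (j i) : ℤ) := by
    rw [sub_eq_add_neg, add_pow, coeff_sum]
    refine Finset.sum_congr rfl fun k _ => ?_
    have hconst : (-1 : MvPolynomial (Fin n) ℤ) ^ (p - k) * (p.choose k : MvPolynomial (Fin n) ℤ) =
        C ((-1) ^ (p - k) * (p.choose k : ℤ)) := by simp
    rw [mul_assoc, hconst, mul_comm, coeff_C_mul, ← Finset.prod_pow]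
    simp_rw [← pow_mul]
    rw [coeff_prod_X_add_one_pow]
  simp_rw [hcoeff, Finset.mul_sum]
  rw [Finset.sum_comm]
  refine Finset.sum_congr rfl fun k _ => ?_
  simp_rw [truncatedAlternatingSum]
  rw [Finset.prod_univ_sum, Finset.mul_sum]
  refine Finset.sum_congr rfl fun j _ => ?_
  rw [Finset.prod_mul_distrib, Finset.prod_pow_eq_pow_sum]
  simp only [Finsupp.coe_equivFunOnFinite_symm]
  ring

theorem stmt_0 (p n : ℕ) (hp : p.Prime) (hodd : Odd p) (hn : 2 ≤ n)
    (m : Fin n → ℕ) (hm : ∀ i, 1 ≤ m i ∧ m i ≤ p - 1) :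
    (p : ℤ) ^ 2 ∣
      ∑ j ∈ Fintype.piFinset (fun _ : Fin n => Finset.Icc 1 (p - 1)),
        (-1 : ℤ) ^ (∑ i, j i) *
          MvPolynomial.coeff (Finsupp.equivFunOnFinite.symm j)
            (((∏ i, (X i + 1) ^ m i) - 1) ^ p : MvPolynomial (Fin n) ℤ) := by
  rw [sum_coeff_prod_pow_sub_one_pow]
  have hends (k : ℕ) (hk : p ∣ k) :
      (p : ℤ) ^ 2 ∣ ∏ i, truncatedAlternatingSum p (m i * k) := by
    have hprod : (p : ℤ) ^ n ∣ ∏ i, truncatedAlternatingSum p (m i * k) := by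
      simpa using Finset.prod_dvd_prod_of_dvd (s := Finset.univ) (fun _ : Fin n => (p : ℤ)) _
        fun i _ => dvd_truncatedAlternatingSum hp (hk.mul_left (m i))
    exact (pow_dvd_pow _ hn).trans hprod
  have hmiddle (k : ℕ) (hk : ¬ p ∣ k) :
      (p : ℤ) ∣ ∏ i, truncatedAlternatingSum p (m i * k) - (-1) ^ n := by
    rw [← Int.modEq_iff_dvd]
    have hprod := Int.ModEq.prod (n := (p : ℤ)) (s := Finset.univ) (f := fun _ : Fin n => (-1 : ℤ))
      (g := fun i => truncatedAlternatingSum p (m i * k)) fun i _ => by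
        rw [Int.modEq_iff_dvd, sub_neg_eq_add]
        refine dvd_truncatedAlternatingSum_add_one hp fun h => ?_
        refine (hp.dvd_mul.1 h).elim (Nat.not_dvd_of_pos_of_lt (hm i).1 ?_) hk
        have := hm i
        omega
    simpa using hprod
  have hbinom : ∑ k ∈ Finset.Ico 1 p, (-1 : ℤ) ^ (p - k) * (p.choose k : ℤ) = 0 := by
    have h := add_pow (1 : ℤ) (-1) p
    rw [add_neg_cancel, zero_pow hp.ne_zero, Finset.sum_range_succ, Finset.range_eq_Ico,
      Finset.sum_eq_sum_Ico_succ_bot hp.pos] at h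
    simpa [hodd.neg_one_pow] using h.symm
  rw [Finset.sum_range_succ, Finset.range_eq_Ico, Finset.sum_eq_sum_Ico_succ_bot hp.pos]
  refine dvd_add (dvd_add ((hends 0 (dvd_zero p)).mul_left _) ?_) ((hends p dvd_rfl).mul_left _)
  have hsplit : ∑ k ∈ Finset.Ico (0 + 1) p,
      (-1) ^ (p - k) * (p.choose k : ℤ) * ∏ i, truncatedAlternatingSum p (m i * k) =
      ∑ k ∈ Finset.Ico 1 p, (-1) ^ (p - k) * (p.choose k : ℤ) *
        (∏ i, truncatedAlternatingSum p (m i * k) - (-1) ^ n) := by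
    simp_rw [mul_sub]
    rw [Finset.sum_sub_distrib, ← Finset.sum_mul, hbinom, zero_mul, sub_zero, zero_add]
  rw [hsplit]
  refine Finset.dvd_sum fun k hk => ?_
  rw [Finset.mem_Ico] at hk
  rw [sq]
  refine mul_dvd_mul (Dvd.dvd.mul_left ?_ _)
    (hmiddle k (Nat.not_dvd_of_pos_of_lt hk.1 hk.2))
  exact Int.natCast_dvd_natCast.2 (hp.dvd_choose_self (by omega) hk.2)
end

section
/- Let p be a prime, let m ≥ 1 be an integer, and let j be an integer with 1 ≤ j ≤ p−1. Then C(pm, j) ≡ m·C(p, j) (mod p²), i.e. p² divides C(pm, j) − m·C(p, j) as integers. -/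
/-- Below `p`, binomial coefficients modulo `p` depend only on the residue of the top entry. -/
theorem Nat.Prime.choose_modEq_choose_of_modEq {p : ℕ} (hp : p.Prime) {a b k : ℕ}
    (hab : a ≡ b [MOD p]) (hk : k < p) :
    (a.choose k : ℤ) ≡ b.choose k [ZMOD p] := by
  have : Fact p.Prime := ⟨hp⟩
  have lucas (n : ℕ) : n.choose k ≡ (n % p).choose k [MOD p] := by
    simpa [Nat.mod_eq_of_lt hk, Nat.div_eq_of_lt hk] using
      Choose.choose_modEq_choose_mod_mul_choose_div_nat (n := n) (k := k) (p := p)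
  have ha := lucas a
  rw [hab] at ha
  exact (Int.natCast_modEq_iff).2 (ha.trans (lucas b).symm)

theorem stmt_2 (p m j : ℕ) (hp : p.Prime) (hm : 1 ≤ m) (hj1 : 1 ≤ j) (hj2 : j ≤ p - 1) :
    (p : ℤ) ^ 2 ∣ (Nat.choose (p * m) j : ℤ) - (m : ℤ) * (Nat.choose p j : ℤ) := by
  have hp1 := hp.one_lt
  obtain ⟨q, rfl⟩ : ∃ q, p = q + 1 := ⟨p - 1, by omega⟩
  obtain ⟨n, rfl⟩ : ∃ n, m = n + 1 := ⟨m - 1, by omega⟩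
  obtain ⟨k, rfl⟩ : ∃ k, j = k + 1 := ⟨j - 1, by omega⟩
  have top : (q + 1) * (n + 1) = (q + (q + 1) * n) + 1 := by ring
  have absorb_mul := Nat.add_one_mul_choose_eq (q + (q + 1) * n) k
  have absorb := Nat.add_one_mul_choose_eq q k
  rw [← top] at absorb_mul
  have hmod : q ≡ q + (q + 1) * n [MOD q + 1] := by simp [Nat.ModEq]
  obtain ⟨c, hc⟩ := (hp.choose_modEq_choose_of_modEq hmod (by omega : k < q + 1)).dvd
  have hcop : IsCoprime (((q + 1 : ℕ) : ℤ) ^ 2) ((k + 1 : ℕ) : ℤ) :=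
    (Nat.isCoprime_iff_coprime.2
      (Nat.coprime_of_lt_prime k.succ_ne_zero (by omega) hp)).pow_left
  refine hcop.dvd_of_dvd_mul_right ⟨(n + 1) * c, ?_⟩
  zify at absorb_mul absorb
  push_cast at hc ⊢
  linear_combination -absorb_mul + ((n : ℤ) + 1) * absorb + ((q : ℤ) + 1) * (n + 1) * hc
end

section
/- Let p be a prime, let r ≥ 1 be an integer, let m₁, …, m_r ≥ 1 be integers, and let j₁, …, j_r be integers with 1 ≤ jᵢ ≤ p−1 for all i. Then p^{r+1} divides ∏_{i=1}^{r} C(p·mᵢ, jᵢ) − ∏_{i=1}^{r} mᵢ·C(p, jᵢ) as integers. (Equivalently: the coefficient of s₁^{j₁}⋯s_r^{j_r} in ∏_{i=1}^{r}(sᵢ+1)^{p mᵢ} is congruent to ∏_{i=1}^{r} mᵢ·C(p, jᵢ) modulo p^{r+1}.) -/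
theorem pow_card_succ_dvd_prod_sub_prod {ι R : Type*} [CommRing R] (c : R) (a b : ι → R)
    (s : Finset ι) (hb : ∀ i ∈ s, c ∣ b i) (hab : ∀ i ∈ s, c ^ 2 ∣ a i - b i) :
    c ^ (s.card + 1) ∣ ∏ i ∈ s, a i - ∏ i ∈ s, b i := by
  classical
  induction s using Finset.induction_on with
  | empty => simp
  | insert i s hi ih =>
    rw [Finset.forall_mem_insert] at hb hab
    have ha : c ∣ a i := by
      simpa using dvd_add ((dvd_pow_self c two_ne_zero).trans hab.1) hb.1
    have hprod : c ^ s.card ∣ ∏ k ∈ s, b k := by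
      simpa using Finset.prod_dvd_prod_of_dvd (fun _ => c) b hb.2
    rw [Finset.prod_insert hi, Finset.prod_insert hi, Finset.card_insert_of_notMem hi]
    have h₁ := mul_dvd_mul ha (ih hb.2 hab.2)
    have h₂ := mul_dvd_mul hab.1 hprod
    rw [show c * c ^ (s.card + 1) = c ^ (s.card + 1 + 1) by ring] at h₁
    rw [show c ^ 2 * c ^ s.card = c ^ (s.card + 1 + 1) by ring] at h₂
    convert dvd_add h₁ h₂ using 1
    ring

theorem Nat.Prime.sq_dvd_choose_mul_sub {p : ℕ} (hp : p.Prime) {m j : ℕ} (hm : 1 ≤ m)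
    (hj : 1 ≤ j) (hjp : j < p) :
    (p : ℤ) ^ 2 ∣ (Nat.choose (p * m) j : ℤ) - m * Nat.choose p j := by
  have : Fact p.Prime := ⟨hp⟩
  obtain ⟨n, rfl⟩ := Nat.exists_eq_add_of_le' hm
  obtain ⟨k, rfl⟩ := Nat.exists_eq_add_of_le' hj
  obtain ⟨q, rfl⟩ := Nat.exists_eq_add_of_le' hp.one_le
  have lucas : (Nat.choose ((q + 1) * n + q) k : ℤ) ≡ Nat.choose q k [ZMOD (q + 1 : ℕ)] := by
    have h := Choose.choose_modEq_choose_mod_mul_choose_div (n := (q + 1) * n + q) (k := k)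
      (p := q + 1)
    rwa [Nat.mul_add_mod, Nat.mod_eq_of_lt (lt_add_one q),
      Nat.mod_eq_of_lt (by omega : k < q + 1), Nat.div_eq_of_lt (by omega : k < q + 1),
      Nat.choose_zero_right, Nat.cast_one, mul_one] at h
  have hcop : IsCoprime (((q + 1 : ℕ) : ℤ) ^ 2) ((k + 1 : ℕ) : ℤ) :=
    (Nat.isCoprime_iff_coprime.mpr
      (Nat.coprime_of_lt_prime (by omega) hjp hp)).pow_left
  apply hcop.dvd_of_dvd_mul_right
  have h₁ := Nat.add_one_mul_choose_eq ((q + 1) * n + q) k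
  have h₂ := Nat.add_one_mul_choose_eq q k
  rw [show (q + 1) * n + q + 1 = (q + 1) * (n + 1) by ring] at h₁
  zify at h₁ h₂
  obtain ⟨t, ht⟩ := lucas.symm.dvd
  push_cast at ht ⊢
  exact ⟨(n + 1) * t, by linear_combination -h₁ + (n + 1) * h₂ + (q + 1) * (n + 1) * ht⟩

theorem stmt_4 (p r : ℕ) (hp : p.Prime) (hr : 1 ≤ r)
    (m j : Fin r → ℕ) (hm : ∀ i, 1 ≤ m i) (hj : ∀ i, 1 ≤ j i ∧ j i ≤ p - 1) :
    (p : ℤ) ^ (r + 1) ∣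
      (∏ i, (Nat.choose (p * m i) (j i) : ℤ)) - ∏ i, (m i : ℤ) * (Nat.choose p (j i) : ℤ) := by
  have hjp (i : Fin r) : j i < p := by
    have := hj i
    omega
  have h := pow_card_succ_dvd_prod_sub_prod (p : ℤ) (fun i => (Nat.choose (p * m i) (j i) : ℤ))
    (fun i => (m i : ℤ) * (Nat.choose p (j i) : ℤ)) Finset.univ
    (fun i _ => Dvd.dvd.mul_left (Int.natCast_dvd_natCast.mpr
      (hp.dvd_choose_self (Nat.one_le_iff_ne_zero.mp (hj i).1) (hjp i))) _)
    (fun i _ => hp.sq_dvd_choose_mul_sub (hm i) (hj i).1 (hjp i))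
  rwa [Finset.card_univ, Fintype.card_fin] at h
end

section
/- Let p be an odd prime and m ≥ 1 an integer. Then p² divides the alternating sum ∑_{j=1}^{p−1} (−1)^j · C(pm, j) as an integer. (Equivalently, C(pm−1, p−1) ≡ 1 (mod p²).) -/
/-- If `p` is prime, then `(-1) ^ k * C(p * m - 1, k) ≡ 1 (mod p)` for `k < p`. -/
theorem prime_dvd_neg_one_pow_mul_choose_sub_one {p m : ℕ} (hp : p.Prime) (hm : 1 ≤ m) (k : ℕ)
    (hk : k < p) : (p : ℤ) ∣ (-1) ^ k * ((p * m - 1).choose k : ℤ) - 1 := by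
  obtain ⟨n, hn⟩ : ∃ n, p * m = n + 1 :=
    Nat.exists_eq_succ_of_ne_zero (Nat.mul_ne_zero hp.ne_zero (by lia))
  rw [hn, Nat.add_sub_cancel]
  induction k with
  | zero => simp
  | succ k ih =>
    have hdvd : p ∣ (n + 1).choose (k + 1) :=
      (Nat.coprime_of_lt_prime (by lia) hk hp).dvd_of_dvd_mul_right
        (Nat.add_one_mul_choose_eq n k ▸ hn ▸ (dvd_mul_right p m).mul_right _)
    have hpascal : ((n + 1).choose (k + 1) : ℤ) = n.choose k + n.choose (k + 1) :=
      mod_cast Nat.choose_succ_succ n k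
    obtain ⟨c, hc⟩ := ih (by lia)
    obtain ⟨d, hd⟩ := Int.natCast_dvd_natCast.mpr hdvd
    exact ⟨c - (-1) ^ k * d, by linear_combination hc - (-1) ^ k * hd + (-1) ^ k * hpascal⟩

/-- The terms of index `j` and `p - j` in the alternating sum of the `C(p * m, j)` cancel
modulo `p ^ 2`. -/
theorem prime_sq_dvd_choose_add_choose_reflect {p m : ℕ} (hp : p.Prime) (hm : 1 ≤ m) {i j : ℕ}
    (hi : 1 ≤ i) (hj : 1 ≤ j) (hij : i + j = p) :
    (p : ℤ) ^ 2 ∣ (-1) ^ i * ((p * m).choose i : ℤ) + (-1) ^ j * ((p * m).choose j : ℤ) := by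
  have hcop {k : ℕ} (h₀ : 1 ≤ k) (h₁ : k < p) : IsCoprime ((p : ℤ) ^ 2) k :=
    (Nat.isCoprime_iff_coprime.mpr (Nat.coprime_of_lt_prime (by lia) h₁ hp)).pow_left
  have habs {k : ℕ} (h₀ : 1 ≤ k) (h₁ : k < p) : ∃ c : ℤ,
      k * ((-1) ^ k * ((p * m).choose k : ℤ)) = p * m * (p * c - 1) := by
    obtain ⟨l, rfl⟩ := Nat.exists_eq_add_of_le' h₀
    obtain ⟨c, hc⟩ := prime_dvd_neg_one_pow_mul_choose_sub_one hp hm l (by lia)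
    have h : ((p * m : ℕ) : ℤ) * ((p * m - 1).choose l : ℤ) =
        ((p * m).choose (l + 1) : ℤ) * (l + 1 : ℕ) := by
      have hpos : p * m - 1 + 1 = p * m := Nat.sub_add_cancel (Nat.mul_pos hp.pos hm)
      have := Nat.add_one_mul_choose_eq (p * m - 1) l
      rw [hpos] at this
      exact_mod_cast this
    refine ⟨-c, ?_⟩
    push_cast at h ⊢
    linear_combination (-1) ^ l * h - p * m * hc
  obtain ⟨c, hc⟩ := habs hi (by lia)
  obtain ⟨d, hd⟩ := habs hj (by lia)
  refine (hcop hi (by lia)).dvd_of_dvd_mul_left ((hcop hj (by lia)).dvd_of_dvd_mul_left ?_)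
  have hp' : (p : ℤ) = i + j := mod_cast hij.symm
  refine ⟨m * (j * c + i * d - 1), ?_⟩
  linear_combination (j : ℤ) * hc + i * hd + p * m * hp'

theorem stmt_5 (p m : ℕ) (hp : p.Prime) (hodd : Odd p) (hm : 1 ≤ m) :
    (p : ℤ) ^ 2 ∣ ∑ j ∈ Finset.Icc 1 (p - 1), (-1 : ℤ) ^ j * (Nat.choose (p * m) j : ℤ) := by
  have hcop : IsCoprime ((p : ℤ) ^ 2) 2 :=
    (Nat.isCoprime_iff_coprime.mpr hodd.coprime_two_right).pow_left
  refine hcop.dvd_of_dvd_mul_left ?_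
  have hreflect : ∑ j ∈ Finset.Icc 1 (p - 1), (-1 : ℤ) ^ j * ((p * m).choose j : ℤ) =
      ∑ j ∈ Finset.Icc 1 (p - 1), (-1 : ℤ) ^ (p - j) * ((p * m).choose (p - j) : ℤ) := by
    refine Finset.sum_nbij' (p - ·) (p - ·) ?_ ?_ ?_ ?_ ?_ <;> intro j hj <;>
      simp only [Finset.mem_Icc] at * <;> try lia
    rw [Nat.sub_sub_self (by lia)]
  rw [two_mul]
  nth_rewrite 2 [hreflect]
  rw [← Finset.sum_add_distrib]
  refine Finset.dvd_sum fun j hj ↦ ?_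
  rw [Finset.mem_Icc] at hj
  exact prime_sq_dvd_choose_add_choose_reflect hp hm hj.1 (by lia) (by lia)
end

section
/- Let i, j, k ∈ {1, 2} and set P = ((1+a)^i (1+b)^j (1+c)^k − 1)³ in ℤ[a, b, c]. Let β′₁, β′₂, β′₃ denote the coefficients in P of the monomials a²bc, ab²c, abc² respectively, and let β denote the coefficient of abc in P. Then 9 divides each of the differences β′₁ − β′₂, β′₁ − β′₃, β′₂ − β′₃, β − β′₁, β − β′₂, and β − β′₃. -/
open MvPolynomial

theorem one_add_X_pow_eq_sum_monomial {σ R : Type*} [CommSemiring R] (s : σ) (n : ℕ) :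
    (1 + X s : MvPolynomial σ R) ^ n =
      ∑ m ∈ Finset.range (n + 1), monomial (Finsupp.single s m) (n.choose m : R) := by
  rw [add_comm, add_pow]
  refine Finset.sum_congr rfl fun m _ => ?_
  rw [one_pow, mul_one, X_pow_eq_monomial, ← C_eq_coe_nat, mul_comm, C_mul_monomial, mul_one]

theorem single_add_single_add_single_inj {p q r p' q' r' : ℕ} :
    (Finsupp.single 0 p + Finsupp.single 1 q + Finsupp.single 2 r : Fin 3 →₀ ℕ) =
      Finsupp.single 0 p' + Finsupp.single 1 q' + Finsupp.single 2 r' ↔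
      p = p' ∧ q = q' ∧ r = r' := by
  simp [Finsupp.ext_iff, Fin.forall_fin_succ, Finsupp.single_apply]

theorem coeff_one_add_X_pow_mul {R : Type*} [CommSemiring R] (l m n p q r : ℕ) :
    coeff (Finsupp.single 0 p + Finsupp.single 1 q + Finsupp.single 2 r)
      ((1 + X 0) ^ l * (1 + X 1) ^ m * (1 + X 2) ^ n : MvPolynomial (Fin 3) R) =
      l.choose p * m.choose q * n.choose r := by
  have choose_eq_ite (n k : ℕ) :
      (n.choose k : R) = if k < n + 1 then (n.choose k : R) else 0 := by
    split_ifs with h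
    · rfl
    · rw [Nat.choose_eq_zero_of_lt (by omega), Nat.cast_zero]
  simp only [one_add_X_pow_eq_sum_monomial, Finset.sum_mul, Finset.mul_sum,
    monomial_mul, coeff_sum, coeff_monomial, single_add_single_add_single_inj, ite_and,
    Finset.sum_ite_irrel, Finset.sum_const_zero, Finset.sum_ite_eq', Finset.mem_range]
  rw [choose_eq_ite l p, choose_eq_ite m q, choose_eq_ite n r]
  split_ifs <;> simp

theorem coeff_one_add_X_pow_mul_sub_one_cube {R : Type*} [CommRing R] (i j k p q r : ℕ)
    (hp : p ≠ 0) :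
    coeff (Finsupp.single 0 p + Finsupp.single 1 q + Finsupp.single 2 r)
      (((1 + X 0) ^ i * (1 + X 1) ^ j * (1 + X 2) ^ k - 1) ^ 3 : MvPolynomial (Fin 3) R) =
      (i * 3).choose p * (j * 3).choose q * (k * 3).choose r
        - 3 * ((i * 2).choose p * (j * 2).choose q * (k * 2).choose r)
        + 3 * (i.choose p * j.choose q * k.choose r) := by
  have expand (t : MvPolynomial (Fin 3) R) :
      (t - 1) ^ 3 = t ^ 3 - C 3 * t ^ 2 + C 3 * t - 1 := by
    rw [map_ofNat]; ring
  have h_ne : (0 : Fin 3 →₀ ℕ) ≠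
      Finsupp.single 0 p + Finsupp.single 1 q + Finsupp.single 2 r := by
    intro h
    have := DFunLike.congr_fun h 0
    simp at this
    omega
  simp only [expand, mul_pow, ← pow_mul, coeff_sub, coeff_add, coeff_C_mul,
    coeff_one_add_X_pow_mul, coeff_one, if_neg h_ne, sub_zero]

theorem stmt_9 (i j k : ℕ) (hi : i = 1 ∨ i = 2) (hj : j = 1 ∨ j = 2) (hk : k = 1 ∨ k = 2) :
    let P : MvPolynomial (Fin 3) ℤ :=
      ((1 + X 0) ^ i * (1 + X 1) ^ j * (1 + X 2) ^ k - 1) ^ 3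
    let β'₁ := MvPolynomial.coeff
      (Finsupp.single 0 2 + Finsupp.single 1 1 + Finsupp.single 2 1) P
    let β'₂ := MvPolynomial.coeff
      (Finsupp.single 0 1 + Finsupp.single 1 2 + Finsupp.single 2 1) P
    let β'₃ := MvPolynomial.coeff
      (Finsupp.single 0 1 + Finsupp.single 1 1 + Finsupp.single 2 2) P
    let β := MvPolynomial.coeff
      (Finsupp.single 0 1 + Finsupp.single 1 1 + Finsupp.single 2 1) P
    (9 : ℤ) ∣ β'₁ - β'₂ ∧ (9 : ℤ) ∣ β'₁ - β'₃ ∧ (9 : ℤ) ∣ β'₂ - β'₃ ∧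
    (9 : ℤ) ∣ β - β'₁ ∧ (9 : ℤ) ∣ β - β'₂ ∧ (9 : ℤ) ∣ β - β'₃ := by
  intro P β'₁ β'₂ β'₃ β
  simp only [β'₁, β'₂, β'₃, β, P,
    coeff_one_add_X_pow_mul_sub_one_cube _ _ _ _ _ _ one_ne_zero,
    coeff_one_add_X_pow_mul_sub_one_cube _ _ _ _ _ _ two_ne_zero]
  rcases hi with rfl | rfl <;> rcases hj with rfl | rfl <;> rcases hk with rfl | rfl <;>
    norm_num [Nat.choose]
end

section
/- Let R be the quotient ring ℤ[y₁, y₂, y₃, y₄]/(y₁², y₂², y₃², y₄²). For indices i, j set ℓ_{ij} = (1+yᵢ)(1+yⱼ) − 1 in R, and set z′ = (y₁+y₂)(y₃+y₄), u = y₁y₂y₃ + y₁y₂y₄, v = y₁y₃y₄ + y₂y₃y₄. Then the elementary symmetric polynomials e₁, e₂, e₃, e₄ evaluated at the four elements ℓ₁₃, ℓ₁₄, ℓ₂₃, ℓ₂₄ of R satisfy: e₁ = 2(y₁+y₂+y₃+y₄) + z′; e₂ = 2y₁y₂y₃y₄ + 3z′ + 4(u + v + y₁y₂ + y₃y₄);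 e₃ = 4(u + v + 3y₁y₂y₃y₄); e₄ = 2y₁y₂y₃y₄. -/
open MvPolynomial

/-- The quotient ring ℤ[y₁, y₂, y₃, y₄]/(y₁², y₂², y₃², y₄²). -/
noncomputable abbrev R4 : Type :=
  MvPolynomial (Fin 4) ℤ ⧸
    Ideal.span (Set.range fun i : Fin 4 => (X i : MvPolynomial (Fin 4) ℤ) ^ 2)

/-- The class of the variable yᵢ in R4. -/
noncomputable abbrev y (i : Fin 4) : R4 := Ideal.Quotient.mk _ (X i)

theorem y_sq (i : Fin 4) : y i ^ 2 = 0 := by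
  rw [y, ← map_pow]
  exact Ideal.Quotient.eq_zero_iff_mem.mpr (Ideal.subset_span ⟨i, rfl⟩)

theorem Multiset.esymm_one_of_four {R : Type*} [CommSemiring R] (a b c d : R) :
    ({a, b, c, d} : Multiset R).esymm 1 = a + b + c + d := by
  simp [Multiset.esymm, Multiset.insert_eq_cons, ← Multiset.cons_zero, Multiset.powersetCard_one]
  ring

theorem Multiset.esymm_two_of_four {R : Type*} [CommSemiring R] (a b c d : R) :
    ({a, b, c, d} : Multiset R).esymm 2 = a * b + a * c + a * d + b * c + b * d + c * d := by
  simp [Multiset.esymm, Multiset.insert_eq_cons, ← Multiset.cons_zero, Multiset.powersetCard_one,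
    Multiset.powersetCard_cons]
  ring

theorem Multiset.esymm_three_of_four {R : Type*} [CommSemiring R] (a b c d : R) :
    ({a, b, c, d} : Multiset R).esymm 3 = a * b * c + a * b * d + a * c * d + b * c * d := by
  simp [Multiset.esymm, Multiset.insert_eq_cons, ← Multiset.cons_zero, Multiset.powersetCard_one,
    Multiset.powersetCard_cons]
  ring

theorem Multiset.esymm_four_of_four {R : Type*} [CommSemiring R] (a b c d : R) :
    ({a, b, c, d} : Multiset R).esymm 4 = a * b * c * d := by
  simp [Multiset.esymm, Multiset.insert_eq_cons, ← Multiset.cons_zero, Multiset.powersetCard_one,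
    Multiset.powersetCard_cons]
  ring

theorem stmt_10 :
    let ℓ : Fin 4 → Fin 4 → R4 := fun i j => (1 + y i) * (1 + y j) - 1
    let z' : R4 := (y 0 + y 1) * (y 2 + y 3)
    let u : R4 := y 0 * y 1 * y 2 + y 0 * y 1 * y 3
    let v : R4 := y 0 * y 2 * y 3 + y 1 * y 2 * y 3
    let s : Multiset R4 := {ℓ 0 2, ℓ 0 3, ℓ 1 2, ℓ 1 3}
    s.esymm 1 = 2 * (y 0 + y 1 + y 2 + y 3) + z' ∧
    s.esymm 2 = 2 * (y 0 * y 1 * y 2 * y 3) + 3 * z' + 4 * (u + v + y 0 * y 1 + y 2 * y 3) ∧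
    s.esymm 3 = 4 * (u + v + 3 * (y 0 * y 1 * y 2 * y 3)) ∧
    s.esymm 4 = 2 * (y 0 * y 1 * y 2 * y 3) := by
  intro ℓ z' u v s
  simp only [s, Multiset.esymm_one_of_four, Multiset.esymm_two_of_four,
    Multiset.esymm_three_of_four, Multiset.esymm_four_of_four, ℓ, z', u, v]
  have h₀ := y_sq 0
  have h₁ := y_sq 1
  have h₂ := y_sq 2
  have h₃ := y_sq 3
  generalize y 0 = a at *
  generalize y 1 = b at *
  generalize y 2 = c at *
  generalize y 3 = d at *
  refine ⟨by ring, ?_, ?_, ?_⟩ <;> grind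
end
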